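/- Let P be a finite set of points in the Euclidean plane ℝ², d : P × P → ℝ a demand table with d(p,q) ≥ 0 for all p, q, D ≥ 0, and m ∈ ℕ. For any family of m zones S₁, …, S_m ⊆ P each satisfying the diameter constraint (dist(p,q) ≤ D for all p, q ∈ S_k), the family of convex-hull extensions S'_k := {p ∈ P : p ∈ convexHull(S_k)}, k = 1, …, m, also consists of zones satisfying the diameter constraint, and its covered demand is at least the covered demand of (S₁, …, S_m). Consequently, every 'hollow' zone is dominated by its convex-hull extension, and discarding non-convex cliques in CliqueGen does not affect the optimal value of the zoning problem. -/

import Mathlib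

open scoped Classical

/-- given a family of `m` zones in the plane each satisfying the
diameter constraint `D`, the family of their convex-hull extensions within the
finite ground set `P` still consists of zones satisfying the diameter
constraint, and its covered demand is at least that of the original family.
Hence every 'hollow' zone is dominated by its convex-hull extension. -/
theorem convexHullExtend_dominates
    (P : Finset (EuclideanSpace ℝ (Fin 2)))
    (d : EuclideanSpace ℝ (Fin 2) → EuclideanSpace ℝ (Fin 2) → ℝ)
    (hd : ∀ p q, 0 ≤ d p q)
    (D : ℝ) (hD : 0 ≤ D) (m : ℕ)
    (S : Fin m → Finset (EuclideanSpace ℝ (Fin 2)))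
    (hSP : ∀ k, S k ⊆ P)
    (hdiam : ∀ k, ∀ p ∈ S k, ∀ q ∈ S k, dist p q ≤ D) :
    (∀ k, ∀ p ∈ P.filter (fun p => p ∈ convexHull ℝ ((S k : Finset _) : Set (EuclideanSpace ℝ (Fin 2)))),
        ∀ q ∈ P.filter (fun p => p ∈ convexHull ℝ ((S k : Finset _) : Set (EuclideanSpace ℝ (Fin 2)))),
          dist p q ≤ D) ∧
    (∑ p ∈ P, ∑ q ∈ P, d p q * (if ∃ k, p ∈ S k ∧ q ∈ S k then 1 else 0)) ≤
      ∑ p ∈ P, ∑ q ∈ P, d p q *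
        (if ∃ k, p ∈ P.filter (fun r => r ∈ convexHull ℝ ((S k : Finset _) : Set (EuclideanSpace ℝ (Fin 2)))) ∧
               q ∈ P.filter (fun r => r ∈ convexHull ℝ ((S k : Finset _) : Set (EuclideanSpace ℝ (Fin 2))))
         then 1 else 0) := by
  refine ⟨fun k p hp q hq => ?_, ?_⟩
  · obtain ⟨p', hp', q', hq', h⟩ :=
      convexHull_exists_dist_ge2 (Finset.mem_filter.1 hp).2 (Finset.mem_filter.1 hq).2
    exact h.trans (hdiam k p' hp' q' hq')
  · have subset_extend : ∀ k, ∀ p ∈ S k,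
        p ∈ P.filter (fun r => r ∈ convexHull ℝ (S k : Set (EuclideanSpace ℝ (Fin 2)))) :=
      fun k p hp => Finset.mem_filter.2 ⟨hSP k hp, subset_convexHull ℝ _ hp⟩
    refine Finset.sum_le_sum fun p _ => Finset.sum_le_sum fun q _ =>
      mul_le_mul_of_nonneg_left ?_ (hd p q)
    split_ifs with h h'
    · exact le_rfl
    · obtain ⟨k, hp, hq⟩ := h
      exact absurd ⟨k, subset_extend k p hp, subset_extend k q hq⟩ h'
    · exact zero_le_one
    · exact le_rfl
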